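/- arXiv:1910.12697 — 5 statements merged into one kernel-verified Lean document; each statement's English description precedes it below -/
import Mathlib

section
/- Let K ≥ 1 be an integer, let P = {q ∈ ℝ^K : q_u ≥ 0 for all u and Σ_{u=1}^K q_u = 1} be the probability simplex, let Θ be a nonempty set, and let d_1, …, d_K : Θ → ℝ be nonnegative functions. Then the function f : P → ℝ defined by f(q) = inf_{ϑ ∈ Θ} Σ_{u=1}^K q_u d_u(ϑ) is lower semicontinuous at every point of P (including points on the boundary of the simplex where some coordinates vanish). -/
open Finset Filter

/-- The standard probability simplex in `ℝ^K`. -/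
def simplex (K : ℕ) : Set (Fin K → ℝ) := {q | (∀ u, 0 ≤ q u) ∧ ∑ u, q u = 1}

/-- For `K ≥ 1`, a nonempty index set `Θ` and nonnegative functions
`d u : Θ → ℝ`, the function `f q = inf_{ϑ ∈ Θ} ∑ u, q u * d u ϑ` is lower semicontinuous
at every point of the probability simplex, in the sequential sense: for every `q₀` in the
simplex and every sequence `qseq` in the simplex converging to `q₀`,
`f q₀ ≤ liminf_n f (qseq n)`. -/
theorem lsc_inf_weighted_divergence_on_simplex
    (K : ℕ) (hK : 1 ≤ K) (Θ : Type*) [Nonempty Θ]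
    (d : Fin K → Θ → ℝ) (hd : ∀ u ϑ, 0 ≤ d u ϑ)
    (q₀ : Fin K → ℝ) (hq₀ : q₀ ∈ simplex K)
    (qseq : ℕ → Fin K → ℝ) (hqseq : ∀ n, qseq n ∈ simplex K)
    (hconv : Tendsto qseq atTop (nhds q₀)) :
    (⨅ ϑ : Θ, ∑ u, q₀ u * d u ϑ) ≤
      Filter.liminf (fun n => ⨅ ϑ : Θ, ∑ u, qseq n u * d u ϑ) atTop := by
  set f : (Fin K → ℝ) → ℝ := fun q => ⨅ ϑ : Θ, ∑ u, q u * d u ϑ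
  have hbdd : ∀ q ∈ simplex K, BddBelow (Set.range fun ϑ : Θ => ∑ u, q u * d u ϑ) := by
    rintro q hq
    refine ⟨0, ?_⟩
    rintro _ ⟨ϑ, rfl⟩
    exact Finset.sum_nonneg fun u _ => mul_nonneg (hq.1 u) (hd u ϑ)
  obtain ⟨ϑ₀⟩ := ‹Nonempty Θ›
  have : Nonempty Θ := ⟨ϑ₀⟩
  have hcobdd : IsCoboundedUnder (· ≥ ·) atTop fun n => f (qseq n) := by
    refine IsBoundedUnder.isCoboundedUnder_ge (isBoundedUnder_of ⟨∑ u, d u ϑ₀, fun n => ?_⟩)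
    refine (ciInf_le (hbdd _ (hqseq n)) ϑ₀).trans (Finset.sum_le_sum fun u _ => ?_)
    refine mul_le_of_le_one_left (hd u ϑ₀) ?_
    rw [← (hqseq n).2]
    exact Finset.single_le_sum (fun v _ => (hqseq n).1 v) (Finset.mem_univ u)
  have hscaled : ∀ c ∈ Set.Ioo (0 : ℝ) 1,
      c * f q₀ ≤ liminf (fun n => f (qseq n)) atTop := by
    rintro c ⟨hc0, hc1⟩
    refine le_liminf_of_le hcobdd ?_
    have hdom : ∀ᶠ n in atTop, ∀ u, c * q₀ u ≤ qseq n u := by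
      refine eventually_all.2 fun u => ?_
      rcases (hq₀.1 u).eq_or_lt with h | h
      · exact Eventually.of_forall fun n => by simpa [← h] using (hqseq n).1 u
      · exact ((tendsto_pi_nhds.1 hconv u).eventually_const_lt
          (mul_lt_of_lt_one_left h hc1)).mono fun n hn => hn.le
    filter_upwards [hdom] with n hn
    refine le_ciInf fun ϑ => ?_
    calc c * f q₀ ≤ c * ∑ u, q₀ u * d u ϑ :=
          mul_le_mul_of_nonneg_left (ciInf_le (hbdd q₀ hq₀) ϑ) hc0.le
      _ = ∑ u, c * q₀ u * d u ϑ := by simp only [Finset.mul_sum, mul_assoc]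
      _ ≤ ∑ u, qseq n u * d u ϑ :=
          Finset.sum_le_sum fun u _ => mul_le_mul_of_nonneg_right (hn u) (hd u ϑ)
  have hlim : Tendsto (fun c : ℝ => c * f q₀) (nhdsWithin 1 (Set.Iio 1)) (nhds (f q₀)) := by
    have h : Continuous fun c : ℝ => c * f q₀ := by fun_prop
    simpa using (h.tendsto 1).mono_left nhdsWithin_le_nhds
  refine le_of_tendsto hlim ?_
  filter_upwards [Ioo_mem_nhdsLT (zero_lt_one (α := ℝ))] with c hc using hscaled c hc
end

section
/- Let K ≥ 1 and M ≥ 2 be integers. For each u ∈ {1,…,K} let A_u : ℝ → ℝ be convex and differentiable, and define D_u(θ‖θ') = A_u(θ'_u) − A_u(θ_u) − A_u'(θ_u)(θ'_u − θ_u) for θ, θ' ∈ ℝ^K. Let Θ_1, …, Θ_M ⊆ ℝ^K be nonempty sets such that: (i) each Θ_m is a disjoint finite union Θ_m = ⋃_{i=1}^{x_m} Γ_m^{(i)}; (ii) each Γ_m^{(i)} is convex and open in its own affine hull; (iii) all the sets Γ_m^{(i)} over all pairs (m,i) are pairwise disjoint; (iv) every θ ∈ Γ_m^{(i)} has strictly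 positive distance (in a fixed norm on ℝ^K) to every other set Γ_{m'}^{(j)} with (m',j) ≠ (m,i). For θ ∈ ⋃_m Θ_m let g(θ) denote the unique m with θ ∈ Θ_m, and suppose ⋃_m Θ_m \ Θ_{g(θ)} is nonempty for every such θ. Then the function f₀ : P × ⋃_m Θ_m → ℝ defined by f₀(q, θ) = inf_{θ' ∈ ⋃_m Θ_m \ Θ_{g(θ)}} Σ_{u=1}^K q_u D_u(θ‖θ') is jointly continuous: whenever q_n → q₀ in the probability simplex P and θ_n → θ₀ in ⋃_m Θ_m, one has f₀(q_n, θ_n) → f₀(q₀, θ₀). -/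
open Finset Filter

/-- Kullback–Leibler divergence (Bregman form) between the members of the `u`-th
single-parameter exponential family with natural parameters `θ u` and `θ' u`:
`D_u(θ‖θ') = A_u(θ'_u) − A_u(θ_u) − A_u'(θ_u)(θ'_u − θ_u)`. -/
noncomputable def KLdiv (K : ℕ) (A : Fin K → ℝ → ℝ) (θ θ' : Fin K → ℝ) (u : Fin K) : ℝ :=
  A u (θ' u) - A u (θ u) - deriv (A u) (θ u) * (θ' u - θ u)

/-- `f₀(q, θ) = inf_{θ' ∈ ⋃ₘ Θₘ \ Θ_{g(θ)}} ∑ u, q u * D_u(θ‖θ')`. -/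
noncomputable def f0 (K M : ℕ) (A : Fin K → ℝ → ℝ) (Θ : Fin M → Set (Fin K → ℝ))
    (g : (Fin K → ℝ) → Fin M) (q θ : Fin K → ℝ) : ℝ :=
  ⨅ θ' : ((⋃ m, Θ m) \ Θ (g θ) : Set (Fin K → ℝ)), ∑ u, q u * KLdiv K A θ θ' u

/-- The gradient inequality for a differentiable convex function on `ℝ`. -/
lemma ConvexOn.add_deriv_mul_sub_le {A : ℝ → ℝ} (hA : ConvexOn ℝ Set.univ A)
    (hd : Differentiable ℝ A) (s t : ℝ) : A s + deriv A s * (t - s) ≤ A t := by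
  rcases lt_trichotomy s t with h | h | h
  · have := hA.deriv_le_slope (Set.mem_univ s) (Set.mem_univ t) h (hd s)
    rw [slope_def_field, le_div_iff₀ (by linarith)] at this
    linarith
  · simp [h]
  · have := hA.slope_le_deriv (Set.mem_univ t) (Set.mem_univ s) h (hd s)
    rw [slope_def_field, div_le_iff₀ (by linarith)] at this
    linarith

lemma ConvexOn.monotone_deriv_of_differentiable {A : ℝ → ℝ} (hA : ConvexOn ℝ Set.univ A)
    (hd : Differentiable ℝ A) : Monotone (deriv A) := fun _ _ h =>
  hA.monotoneOn_deriv (fun x _ => hd x) (Set.mem_univ _) (Set.mem_univ _) h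

/-- The derivative of a differentiable convex function on `ℝ` is continuous. -/
lemma ConvexOn.continuous_deriv_of_differentiable {A : ℝ → ℝ} (hA : ConvexOn ℝ Set.univ A)
    (hd : Differentiable ℝ A) : Continuous (deriv A) := by
  rw [continuous_iff_continuousAt]
  intro a
  have hslope : Tendsto (slope A a) (nhdsWithin a {a}ᶜ) (nhds (deriv A a)) :=
    hasDerivAt_iff_tendsto_slope.mp (hd a).hasDerivAt
  have hcont : ∀ s, s ≠ a → ContinuousAt (fun b => slope A b s) a := by
    intro s hs
    simp only [slope_def_field]
    exact (continuousAt_const.sub hd.continuous.continuousAt).div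
      (continuousAt_const.sub continuousAt_id) (sub_ne_zero.mpr hs)
  refine tendsto_order.mpr ⟨fun c hc => ?_, fun c hc => ?_⟩
  · have hl := hslope.mono_left (nhdsWithin_mono a (t := {a}ᶜ) (s := Set.Iio a)
      fun x hx => ne_of_lt hx)
    obtain ⟨s, hs, hsa⟩ := ((hl.eventually_const_lt hc).and self_mem_nhdsWithin).exists
    filter_upwards [(hcont s (ne_of_lt hsa)).eventually_const_lt hs, lt_mem_nhds hsa]
      with b hb hsb
    rw [slope_comm] at hb
    exact hb.trans_le (hA.slope_le_deriv (Set.mem_univ s) (Set.mem_univ b) hsb (hd b))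
  · have hr := hslope.mono_left (nhdsWithin_mono a (t := {a}ᶜ) (s := Set.Ioi a)
      fun x hx => ne_of_gt hx)
    obtain ⟨s, hs, hsa⟩ := ((hr.eventually_lt_const hc).and self_mem_nhdsWithin).exists
    filter_upwards [(hcont s (ne_of_gt hsa)).eventually_lt_const hs, gt_mem_nhds hsa]
      with b hb hsb
    exact (hA.deriv_le_slope (Set.mem_univ b) (Set.mem_univ s) hsb (hd b)).trans_lt hb

/-- The Bregman divergence of a differentiable function on `ℝ`. -/
noncomputable def bregman (A : ℝ → ℝ) (θ t : ℝ) : ℝ := A t - A θ - deriv A θ * (t - θ)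

lemma bregman_nonneg {A : ℝ → ℝ} (hA : ConvexOn ℝ Set.univ A) (hd : Differentiable ℝ A)
    (θ t : ℝ) : 0 ≤ bregman A θ t := by
  have := hA.add_deriv_mul_sub_le hd θ t
  unfold bregman
  linarith

lemma bregman_monotoneOn {A : ℝ → ℝ} (hA : ConvexOn ℝ Set.univ A) (hd : Differentiable ℝ A)
    (θ : ℝ) : MonotoneOn (bregman A θ) (Set.Ici θ) := by
  intro s hs t _ hst
  have h1 := hA.add_deriv_mul_sub_le hd s t
  have h2 := mul_le_mul_of_nonneg_right (hA.monotone_deriv_of_differentiable hd hs)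
    (sub_nonneg.mpr hst)
  unfold bregman
  linarith

lemma bregman_antitoneOn {A : ℝ → ℝ} (hA : ConvexOn ℝ Set.univ A) (hd : Differentiable ℝ A)
    (θ : ℝ) : AntitoneOn (bregman A θ) (Set.Iic θ) := by
  intro s _ t ht hst
  have h1 := hA.add_deriv_mul_sub_le hd t s
  have h2 := mul_le_mul_of_nonneg_right (hA.monotone_deriv_of_differentiable hd ht)
    (sub_nonneg.mpr hst)
  unfold bregman
  linarith

lemma continuous_bregman {A : ℝ → ℝ} (hA : ConvexOn ℝ Set.univ A) (hd : Differentiable ℝ A)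
    : Continuous fun p : ℝ × ℝ => bregman A p.1 p.2 := by
  have := hA.continuous_deriv_of_differentiable hd
  have := hd.continuous
  unfold bregman
  fun_prop

/-- A function monotone on a right half-line nearly attains its truncated supremum. -/
lemma MonotoneOn.exists_forall_min_le_add {h : ℝ → ℝ} {a : ℝ} (hh : MonotoneOn h (Set.Ici a))
    (C : ℝ) {ε : ℝ} (hε : 0 < ε) : ∃ R > a, ∀ t ≥ R, min (h t) C ≤ h R + ε := by
  let S := (fun t => min (h t) C) '' Set.Ici a
  have hne : S.Nonempty := ⟨_, a, Set.self_mem_Ici, rfl⟩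
  have hbdd : BddAbove S := ⟨C, by rintro _ ⟨t, -, rfl⟩; exact min_le_right _ _⟩
  obtain ⟨_, ⟨r, hr, rfl⟩, hlt⟩ := exists_lt_of_lt_csSup hne (sub_lt_self (sSup S) hε)
  have hra : a ≤ r := hr
  refine ⟨r + 1, by linarith, fun t ht => ?_⟩
  have h1 : min (h t) C ≤ sSup S :=
    le_csSup hbdd ⟨t, by simp only [Set.mem_Ici]; linarith, rfl⟩
  have h2 : h r ≤ h (r + 1) := hh hr (by simp only [Set.mem_Ici]; linarith) (by linarith)
  have h3 : min (h r) C ≤ h r := min_le_left _ _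
  linarith

/-- A weighted Bregman divergence, truncated at height `C`, is lower semicontinuous in the weight
and the base point, uniformly in the second argument. -/
lemma eventually_forall_min_mul_bregman_sub_le {A : ℝ → ℝ} (hA : ConvexOn ℝ Set.univ A)
    (hd : Differentiable ℝ A) {q₀ : ℝ} (hq₀ : 0 ≤ q₀) (θ₀ C : ℝ) {ε : ℝ} (hε : 0 < ε) :
    ∀ᶠ p : ℝ × ℝ in nhds (q₀, θ₀), 0 ≤ p.1 →
      ∀ t, min (q₀ * bregman A θ₀ t) C - ε ≤ p.1 * bregman A p.2 t := by
  have hmono : MonotoneOn (fun t => q₀ * bregman A θ₀ t) (Set.Ici θ₀) :=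
    fun s hs t ht hst => mul_le_mul_of_nonneg_left (bregman_monotoneOn hA hd θ₀ hs ht hst) hq₀
  have hanti : MonotoneOn (fun t => q₀ * bregman A θ₀ (-t)) (Set.Ici (-θ₀)) :=
    fun s hs t ht hst => mul_le_mul_of_nonneg_left
      (bregman_antitoneOn hA hd θ₀ (Set.mem_Iic.mpr (neg_le.mp ht))
        (Set.mem_Iic.mpr (neg_le.mp hs)) (neg_le_neg hst)) hq₀
  obtain ⟨R, hR, hRt⟩ := hmono.exists_forall_min_le_add C (half_pos hε)
  obtain ⟨L, hL, hLt⟩ := hanti.exists_forall_min_le_add C (half_pos hε)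
  have hcb := continuous_bregman hA hd
  have hunif : ∀ᶠ p : ℝ × ℝ in nhds (q₀, θ₀), ∀ t ∈ Set.Icc (-L) R,
      q₀ * bregman A θ₀ t - ε / 2 < p.1 * bregman A p.2 t := by
    refine isCompact_Icc.eventually_forall_of_forall_eventually fun t _ => ?_
    have hl : Continuous fun z : (ℝ × ℝ) × ℝ => q₀ * bregman A θ₀ z.2 - ε / 2 := by
      have : Continuous fun z : (ℝ × ℝ) × ℝ => bregman A θ₀ z.2 :=
        hcb.comp (continuous_const.prodMk continuous_snd)
      fun_prop
    have hr : Continuous fun z : (ℝ × ℝ) × ℝ => z.1.1 * bregman A z.1.2 z.2 := by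
      have : Continuous fun z : (ℝ × ℝ) × ℝ => bregman A z.1.2 z.2 :=
        hcb.comp ((continuous_snd.comp continuous_fst).prodMk continuous_snd)
      fun_prop
    exact hl.continuousAt.eventually_lt hr.continuousAt (by simp only; linarith)
  have hIoo : ∀ᶠ p : ℝ × ℝ in nhds (q₀, θ₀), p.2 ∈ Set.Ioo (-L) R :=
    continuous_snd.continuousAt.eventually (Ioo_mem_nhds (neg_lt.mp hL) hR)
  filter_upwards [hunif, hIoo] with p hp hpI hp0 t
  have hLR : -L ≤ R := (hpI.1.trans hpI.2).le
  rcases le_total R t with ht | ht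
  · have h1 := hRt t ht
    have h2 := hp R ⟨hLR, le_rfl⟩
    have h3 := mul_le_mul_of_nonneg_left
      (bregman_monotoneOn hA hd p.2 hpI.2.le (hpI.2.le.trans ht) ht) hp0
    linarith
  rcases le_total t (-L) with htL | htL
  · have h1 := hLt (-t) (le_neg.mp htL)
    have h2 := hp (-L) ⟨le_rfl, hLR⟩
    have h3 := mul_le_mul_of_nonneg_left
      (bregman_antitoneOn hA hd p.2 (htL.trans hpI.1.le) hpI.1.le htL) hp0
    simp only [neg_neg] at h1
    linarith
  · have h1 := hp t ⟨htL, ht⟩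
    have h2 := min_le_left (q₀ * bregman A θ₀ t) C
    linarith

lemma le_sum_min_of_le_sum {ι : Type*} [Fintype ι] {a : ι → ℝ} {C : ℝ} (ha : ∀ u, 0 ≤ a u)
    (hC : 0 ≤ C) (hCa : C ≤ ∑ u, a u) : C ≤ ∑ u, min (a u) C := by
  by_cases h : ∃ u, C ≤ a u
  · obtain ⟨u, hu⟩ := h
    calc C = min (a u) C := (min_eq_right hu).symm
      _ ≤ ∑ v, min (a v) C :=
        single_le_sum (f := fun v => min (a v) C) (fun v _ => le_min (ha v) hC) (mem_univ u)
  · push Not at h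
    simpa only [min_eq_left (h _).le] using hCa

/-- The infimum of a weighted sum of Bregman divergences over an arbitrary nonempty set is
sequentially continuous in the weights and the base point. -/
lemma tendsto_iInf_sum_mul_KLdiv {K : ℕ} {A : Fin K → ℝ → ℝ}
    (hA : ∀ u, ConvexOn ℝ Set.univ (A u)) (hd : ∀ u, Differentiable ℝ (A u))
    {S : Set (Fin K → ℝ)} (hS : S.Nonempty) {q θ : ℕ → Fin K → ℝ} {q₀ θ₀ : Fin K → ℝ}
    (hq : ∀ n u, 0 ≤ q n u) (hq₀ : ∀ u, 0 ≤ q₀ u)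
    (hqt : Tendsto q atTop (nhds q₀)) (hθt : Tendsto θ atTop (nhds θ₀)) :
    Tendsto (fun n => ⨅ θ' : S, ∑ u, q n u * KLdiv K A (θ n) θ' u) atTop
      (nhds (⨅ θ' : S, ∑ u, q₀ u * KLdiv K A θ₀ θ' u)) := by
  have := hS.to_subtype
  have hterm : ∀ {p : Fin K → ℝ}, (∀ u, 0 ≤ p u) → ∀ ϑ θ' : Fin K → ℝ, ∀ u,
      0 ≤ p u * KLdiv K A ϑ θ' u :=
    fun hp ϑ θ' u => mul_nonneg (hp u) (bregman_nonneg (hA u) (hd u) _ _)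
  have hbdd : ∀ {p : Fin K → ℝ}, (∀ u, 0 ≤ p u) → ∀ ϑ : Fin K → ℝ,
      BddBelow (Set.range fun θ' : S => ∑ u, p u * KLdiv K A ϑ θ' u) := by
    rintro p hp ϑ
    refine ⟨0, ?_⟩
    rintro _ ⟨θ', rfl⟩
    exact sum_nonneg fun u _ => hterm hp ϑ θ' u
  have hpair : ∀ u, Tendsto (fun n => (q n u, θ n u)) atTop (nhds (q₀ u, θ₀ u)) := fun u =>
    (tendsto_pi_nhds.mp hqt u).prodMk_nhds (tendsto_pi_nhds.mp hθt u)
  set C := ⨅ θ' : S, ∑ u, q₀ u * KLdiv K A θ₀ θ' u with hCdef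
  refine tendsto_order.mpr ⟨fun c hc => ?_, fun c hc => ?_⟩
  · have hC : 0 ≤ C := le_ciInf fun θ' => sum_nonneg fun u _ => hterm hq₀ θ₀ θ' u
    obtain ⟨ε, hε, hεc⟩ : ∃ ε > 0, c < C - K * ε := by
      refine ⟨(C - c) / (K + 1), div_pos (sub_pos.mpr hc) (by positivity), ?_⟩
      have hK : (0 : ℝ) < K + 1 := by positivity
      have h1 : (K + 1) * ((C - c) / (K + 1)) = C - c := by field_simp
      have h2 : 0 < (C - c) / (K + 1) := div_pos (sub_pos.mpr hc) hK
      linarith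
    have hev : ∀ᶠ n in atTop, ∀ u, ∀ t,
        min (q₀ u * bregman (A u) (θ₀ u) t) C - ε ≤ q n u * bregman (A u) (θ n u) t := by
      refine eventually_all.mpr fun u => ?_
      filter_upwards [(hpair u).eventually (eventually_forall_min_mul_bregman_sub_le
        (hA u) (hd u) (hq₀ u) (θ₀ u) C hε)] with n hn
      exact hn (hq n u)
    filter_upwards [hev] with n hn
    refine hεc.trans_le (le_ciInf fun θ' => ?_)
    calc C - K * ε
        ≤ ∑ u, min (q₀ u * KLdiv K A θ₀ θ' u) C - K * ε :=
          sub_le_sub_right (le_sum_min_of_le_sum (hterm hq₀ θ₀ θ') hC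
            (ciInf_le (hbdd hq₀ θ₀) θ')) _
      _ = ∑ u, (min (q₀ u * KLdiv K A θ₀ θ' u) C - ε) := by simp [sum_sub_distrib]
      _ ≤ ∑ u, q n u * KLdiv K A (θ n) θ' u := sum_le_sum fun u _ => hn u _
  · obtain ⟨θ', hθ'⟩ := exists_lt_of_ciInf_lt hc
    have hlim : Tendsto (fun n => ∑ u, q n u * KLdiv K A (θ n) θ' u) atTop
        (nhds (∑ u, q₀ u * KLdiv K A θ₀ θ' u)) := by
      refine tendsto_finsetSum _ fun u _ => (tendsto_pi_nhds.mp hqt u).mul ?_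
      exact ((continuous_bregman (hA u) (hd u)).tendsto _).comp
        ((tendsto_pi_nhds.mp hθt u).prodMk_nhds tendsto_const_nhds)
    filter_upwards [hlim.eventually_lt_const hθ'] with n hn
    exact (ciInf_le (hbdd (hq n) (θ n)) θ').trans_lt hn

/-- Under the structural assumptions (i)–(iv) on the composite hypothesis
sets `Θ₁, …, Θ_M ⊆ ℝ^K`, the function `f₀` is jointly continuous: along any sequences
`qseq n → q₀` in the probability simplex and `θseq n → θ₀` in `⋃ₘ Θₘ` one has
`f₀ (qseq n) (θseq n) → f₀ q₀ θ₀`. -/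
theorem f0_jointly_continuous
    (K M : ℕ) (hK : 1 ≤ K) (hM : 2 ≤ M)
    (A : Fin K → ℝ → ℝ) (hAconv : ∀ u, ConvexOn ℝ Set.univ (A u))
    (hAdiff : ∀ u, Differentiable ℝ (A u))
    (Θ : Fin M → Set (Fin K → ℝ)) (hΘne : ∀ m, (Θ m).Nonempty)
    (x : Fin M → ℕ) (Γ : (m : Fin M) → Fin (x m) → Set (Fin K → ℝ))
    -- (i) each `Θ m` is a finite union of the pieces `Γ m i`
    (hdecomp : ∀ m, Θ m = ⋃ i, Γ m i)
    -- (ii) each piece is nonempty, convex, and open in its own affine hull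
    (hΓne : ∀ m i, (Γ m i).Nonempty)
    (hΓconv : ∀ m i, Convex ℝ (Γ m i))
    (hΓopen : ∀ m i, IsOpen ((↑) ⁻¹' (Γ m i) : Set (affineSpan ℝ (Γ m i))))
    -- (iii) all the pieces, over all pairs `(m, i)`, are pairwise disjoint
    (hdisj : ∀ m i m' j, (⟨m, i⟩ : Σ m : Fin M, Fin (x m)) ≠ ⟨m', j⟩ →
      Γ m i ∩ Γ m' j = ∅)
    -- (iv) positive distance from any point of one piece to every other piece
    (hdist : ∀ m i, ∀ θ ∈ Γ m i, ∀ m' j, (⟨m, i⟩ : Σ m : Fin M, Fin (x m)) ≠ ⟨m', j⟩ →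
      0 < Metric.infDist θ (Γ m' j))
    -- `g θ` is the (unique) index of the hypothesis set containing `θ`
    (g : (Fin K → ℝ) → Fin M) (hg : ∀ m, ∀ θ ∈ Θ m, g θ = m)
    -- the alternative set is nonempty
    (halt : ∀ θ ∈ ⋃ m, Θ m, ((⋃ m, Θ m) \ Θ (g θ)).Nonempty)
    (qseq : ℕ → Fin K → ℝ) (hqseq : ∀ n, qseq n ∈ simplex K)
    (q₀ : Fin K → ℝ) (hq₀ : q₀ ∈ simplex K)
    (θseq : ℕ → Fin K → ℝ) (hθseq : ∀ n, θseq n ∈ ⋃ m, Θ m)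
    (θ₀ : Fin K → ℝ) (hθ₀ : θ₀ ∈ ⋃ m, Θ m)
    (hqconv : Tendsto qseq atTop (nhds q₀))
    (hθconv : Tendsto θseq atTop (nhds θ₀)) :
    Tendsto (fun n => f0 K M A Θ g (qseq n) (θseq n)) atTop
      (nhds (f0 K M A Θ g q₀ θ₀)) := by
  obtain ⟨m, hm⟩ := Set.mem_iUnion.mp hθ₀
  obtain ⟨i, hi⟩ := Set.mem_iUnion.mp (hdecomp m ▸ hm)
  have hgθ₀ : g θ₀ = m := hg m θ₀ hm
  have havoid : ∀ᶠ n in atTop, ∀ m' j, m' ≠ m → θseq n ∉ Γ m' j := by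
    refine eventually_all.mpr fun m' => eventually_all.mpr fun j => ?_
    by_cases hne : m' = m
    · simp [hne]
    have hpos := hdist m i θ₀ hi m' j fun h => hne (congrArg Sigma.fst h).symm
    filter_upwards [(((Metric.continuous_infDist_pt (Γ m' j)).tendsto θ₀).comp
      hθconv).eventually_const_lt hpos] with n hn _ hmem
    exact hn.ne' (Metric.infDist_zero_of_mem hmem)
  have hgθ : ∀ᶠ n in atTop, g (θseq n) = m := by
    filter_upwards [havoid] with n hn
    obtain ⟨m', hm'⟩ := Set.mem_iUnion.mp (hθseq n)
    obtain ⟨j, hj⟩ := Set.mem_iUnion.mp (hdecomp m' ▸ hm')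
    by_cases hne : m' = m
    · exact hg m _ (hne ▸ hm')
    · exact absurd hj (hn m' j hne)
  have hlim := tendsto_iInf_sum_mul_KLdiv hAconv hAdiff (halt θ₀ hθ₀)
    (fun n => (hqseq n).1) hq₀.1 hqconv hθconv
  refine hlim.congr' ?_
  filter_upwards [hgθ] with n hn
  rw [f0, hn, hgθ₀]
end

section
/- Let K ≥ 1 be an integer, C ∈ ℝ, and define v(t) = C + log(t(1+log t)^{K+2}) + √(4K·log(t(1+log t)^{K+2})) for t > 1 and w(α) = |log α| + √(4K·|log α|) for α ∈ (0,1). Let D > 0 and let (z(n))_{n≥1} be a real sequence with z(n)/n → D as n → ∞. For α ∈ (0,1) define τ(α) = inf{ n ∈ ℕ, n ≥ 2 : z(n) ≥ v(n) + w(α) }. Then τ(α) is finite for every α ∈ (0,1), and limsup_{α → 0⁺} τ(α)/|log α| ≤ 1/D. -/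
open Filter

/-- `v(t) = C + log(t(1+log t)^{K+2}) + √(4K log(t(1+log t)^{K+2}))`. -/
noncomputable def vfun (K : ℕ) (C : ℝ) (t : ℝ) : ℝ :=
  C + Real.log (t * (1 + Real.log t) ^ (K + 2))
    + Real.sqrt (4 * K * Real.log (t * (1 + Real.log t) ^ (K + 2)))

/-- `w(α) = |log α| + √(4K |log α|)`. -/
noncomputable def wfun (K : ℕ) (α : ℝ) : ℝ :=
  |Real.log α| + Real.sqrt (4 * K * |Real.log α|)

/-- The stopping time `τ(α) = inf {n ≥ 2 : z(n) ≥ v(n) + w(α)}`. -/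
noncomputable def tauStop (K : ℕ) (C : ℝ) (z : ℕ → ℝ) (α : ℝ) : ℕ :=
  sInf {n : ℕ | 2 ≤ n ∧ vfun K C n + wfun K α ≤ z n}

lemma vfun_le_log (K : ℕ) (C : ℝ) {t : ℝ} (ht : 1 ≤ t) :
    vfun K C t ≤ C + 2 * K + 2 * ((K + 3) * Real.log t) := by
  have hlog : 0 ≤ Real.log t := Real.log_nonneg ht
  have hsplit : Real.log (t * (1 + Real.log t) ^ (K + 2))
      = Real.log t + (K + 2) * Real.log (1 + Real.log t) := by
    rw [Real.log_mul (by positivity) (by positivity), Real.log_pow]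
    push_cast
    ring
  have hiter : Real.log (1 + Real.log t) ≤ Real.log t := by
    linarith [Real.log_le_sub_one_of_pos (show 0 < 1 + Real.log t by positivity)]
  have hiter0 : 0 ≤ Real.log (1 + Real.log t) := Real.log_nonneg (by linarith)
  have hK : (0 : ℝ) ≤ K := Nat.cast_nonneg K
  have hupper : Real.log (t * (1 + Real.log t) ^ (K + 2)) ≤ (K + 3) * Real.log t := by
    rw [hsplit]
    nlinarith
  have hnonneg : 0 ≤ Real.log (t * (1 + Real.log t) ^ (K + 2)) := by
    rw [hsplit]
    positivity
  unfold vfun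
  set x := Real.log (t * (1 + Real.log t) ^ (K + 2))
  have hsqrt : Real.sqrt (4 * K * x) ≤ 2 * K + x := by
    apply Real.sqrt_le_iff.2
    constructor
    · positivity
    · nlinarith [sq_nonneg (2 * (K : ℝ) - x), mul_nonneg hK hnonneg]
  linarith

lemma eventually_vfun_add_mul_le (K : ℕ) (C : ℝ) {D δ : ℝ} (hδ : δ < D) {z : ℕ → ℝ}
    (hz : Tendsto (fun n : ℕ => z n / n) atTop (nhds D)) :
    ∀ᶠ n : ℕ in atTop, vfun K C n + δ * n ≤ z n := by
  have hlog : Tendsto (fun n : ℕ => Real.log n / (n : ℝ)) atTop (nhds 0) :=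
    (Real.isLittleO_log_id_atTop.tendsto_div_nhds_zero).comp tendsto_natCast_atTop_atTop
  have hconst : Tendsto (fun n : ℕ => (C + 2 * K) / (n : ℝ)) atTop (nhds 0) :=
    tendsto_const_div_atTop_nhds_zero_nat _
  have hlim : Tendsto (fun n : ℕ => z n / n - (C + 2 * K) / (n : ℝ)
      - 2 * (K + 3) * (Real.log n / (n : ℝ))) atTop (nhds D) := by
    simpa using (hz.sub hconst).sub (hlog.const_mul (2 * ((K : ℝ) + 3)))
  filter_upwards [hlim.eventually (lt_mem_nhds hδ), eventually_ge_atTop 1] with n hn hn1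
  have hn1' : (1 : ℝ) ≤ n := by exact_mod_cast hn1
  have hn0 : (0 : ℝ) < n := by linarith
  have hmul := mul_lt_mul_of_pos_right hn hn0
  have heq : (z n / n - (C + 2 * K) / (n : ℝ) - 2 * (K + 3) * (Real.log n / (n : ℝ))) * n
      = z n - (C + 2 * K) - 2 * (K + 3) * Real.log n := by
    field_simp
  linarith [vfun_le_log K C hn1']

lemma wfun_nonneg (K : ℕ) (α : ℝ) : 0 ≤ wfun K α := by
  unfold wfun
  positivity

/-- Once `v(n) + δ n ≤ z(n)` for all `n ≥ N`, the threshold is crossed by time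
`N + 2 + ⌈w(α)/δ⌉`. -/
lemma crossing_mem {K : ℕ} {C δ : ℝ} (hδ : 0 < δ) {z : ℕ → ℝ} {N : ℕ}
    (hN : ∀ n ≥ N, vfun K C n + δ * n ≤ z n) (α : ℝ) :
    N + 2 + ⌈wfun K α / δ⌉₊ ∈ {n : ℕ | 2 ≤ n ∧ vfun K C n + wfun K α ≤ z n} := by
  refine ⟨by omega, ?_⟩
  have hle : wfun K α / δ ≤ ((N + 2 + ⌈wfun K α / δ⌉₊ : ℕ) : ℝ) :=
    (Nat.le_ceil _).trans (by exact_mod_cast Nat.le_add_left _ _)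
  have hmul := (div_le_iff₀' hδ).1 hle
  linarith [hN (N + 2 + ⌈wfun K α / δ⌉₊) (by omega)]

lemma tauStop_le {K : ℕ} {C δ : ℝ} (hδ : 0 < δ) {z : ℕ → ℝ} {N : ℕ}
    (hN : ∀ n ≥ N, vfun K C n + δ * n ≤ z n) (α : ℝ) :
    (tauStop K C z α : ℝ) ≤ N + 3 + wfun K α / δ := by
  have hle : (tauStop K C z α : ℝ) ≤ ((N + 2 + ⌈wfun K α / δ⌉₊ : ℕ) : ℝ) := by
    exact_mod_cast Nat.sInf_le (crossing_mem hδ hN α)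
  push_cast at hle
  linarith [Nat.ceil_lt_add_one (div_nonneg (wfun_nonneg K α) hδ.le)]

lemma tendsto_abs_log_nhdsGT_zero :
    Tendsto (fun α : ℝ => |Real.log α|) (nhdsWithin 0 (Set.Ioi 0)) atTop :=
  tendsto_abs_atBot_atTop.comp Real.tendsto_log_nhdsGT_zero

lemma tendsto_wfun_div_abs_log (K : ℕ) :
    Tendsto (fun α : ℝ => wfun K α / |Real.log α|) (nhdsWithin 0 (Set.Ioi 0)) (nhds 1) := by
  have hsqrt : Tendsto (fun x : ℝ => 1 + Real.sqrt (4 * K) / Real.sqrt x) atTop (nhds 1) := by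
    simpa using (Real.tendsto_sqrt_atTop.const_div_atTop (Real.sqrt (4 * K))).const_add 1
  refine (hsqrt.comp tendsto_abs_log_nhdsGT_zero).congr' ?_
  filter_upwards [tendsto_abs_log_nhdsGT_zero.eventually_gt_atTop 0] with α hα
  simp only [Function.comp_apply, wfun]
  rw [add_div, div_self hα.ne', Real.sqrt_mul (by positivity : (0 : ℝ) ≤ 4 * K) |Real.log α|,
    mul_div_assoc, Real.sqrt_div_self, ← div_eq_mul_inv]

lemma limsup_tauStop_div_le (K : ℕ) (C : ℝ) {D δ : ℝ} (hδ : 0 < δ) (hδD : δ < D) {z : ℕ → ℝ}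
    (hz : Tendsto (fun n : ℕ => z n / n) atTop (nhds D)) :
    Filter.limsup (fun α : ℝ => ((tauStop K C z α : ℝ) / |Real.log α| : EReal))
      (nhdsWithin 0 (Set.Ioi 0)) ≤ ((1 / δ : ℝ) : EReal) := by
  obtain ⟨N, hN⟩ := eventually_atTop.1 (eventually_vfun_add_mul_le K C hδD hz)
  have hlim : Tendsto (fun α : ℝ => (N + 3) / |Real.log α| + wfun K α / |Real.log α| / δ)
      (nhdsWithin 0 (Set.Ioi 0)) (nhds (1 / δ)) := by
    simpa using (tendsto_abs_log_nhdsGT_zero.const_div_atTop ((N : ℝ) + 3)).add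
      ((tendsto_wfun_div_abs_log K).div_const δ)
  rw [← ((continuous_coe_real_ereal.tendsto _).comp hlim).limsup_eq]
  refine limsup_le_limsup ?_
  filter_upwards [tendsto_abs_log_nhdsGT_zero.eventually_gt_atTop 0] with α hα
  simp only [Function.comp_apply]
  rw [← EReal.coe_div, EReal.coe_le_coe_iff, div_right_comm, ← add_div]
  exact div_le_div_of_nonneg_right (tauStop_le hδ hN α) hα.le

/-- If `z(n)/n → D > 0`, then for every `α ∈ (0,1)` the stopping time
`τ(α) = inf {n ≥ 2 : z(n) ≥ v(n) + w(α)}` is finite (the defining set is nonempty), and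
`limsup_{α → 0⁺} τ(α)/|log α| ≤ 1/D`. -/
theorem stopping_time_asymptotics
    (K : ℕ) (hK : 1 ≤ K) (C : ℝ) (D : ℝ) (hD : 0 < D) (z : ℕ → ℝ)
    (hz : Tendsto (fun n : ℕ => z n / n) atTop (nhds D)) :
    (∀ α ∈ Set.Ioo (0 : ℝ) 1, {n : ℕ | 2 ≤ n ∧ vfun K C n + wfun K α ≤ z n}.Nonempty) ∧
    Filter.limsup (fun α : ℝ => ((tauStop K C z α : ℝ) / |Real.log α| : EReal))
      (nhdsWithin 0 (Set.Ioi 0)) ≤ ((1 / D : ℝ) : EReal) := by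
  constructor
  · intro α _
    obtain ⟨N, hN⟩ := eventually_atTop.1 (eventually_vfun_add_mul_le K C (half_lt_self hD) hz)
    exact ⟨_, crossing_mem (half_pos hD) hN α⟩
  · have hlim : Tendsto (fun δ : ℝ => ((1 / δ : ℝ) : EReal)) (nhdsWithin D (Set.Iio D))
        (nhds ((1 / D : ℝ) : EReal)) :=
      (continuous_coe_real_ereal.tendsto _).comp
        ((tendsto_const_nhds.div tendsto_id hD.ne').mono_left nhdsWithin_le_nhds)
    refine ge_of_tendsto hlim ?_
    filter_upwards [Ioo_mem_nhdsLT hD] with δ hδ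
    exact limsup_tauStop_div_le K C hδ.1 hδ.2 hz
end

section
/- Let K ≥ 1 be an integer and ε > 0, and let N be an integer with N ≥ ((2K+1)/ε)⁴. Let q* be in the probability simplex P ⊂ ℝ^K and let (q(k))_{k≥0} be a sequence in P such that |q_u(k) − q*_u| ≤ ε for every coordinate u and every index k ≥ N^{1/4}. Let (N_u(n))_{u,n} be nonnegative reals satisfying |N_u(n) − Σ_{k=0}^{n−1} q_u(k)| ≤ K(1 + √n) for all u and n. Then for every integer n with √N ≤ n ≤ N and every u ∈ {1,…,K}: |N_u(n)/n − q*_u| ≤ 2ε. -/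
open Finset

theorem abs_sub_le_one_of_mem_simplex {K : ℕ} {p q : Fin K → ℝ} (hp : p ∈ simplex K)
    (hq : q ∈ simplex K) (u : Fin K) : |p u - q u| ≤ 1 := by
  have le_one {r : Fin K → ℝ} (hr : r ∈ simplex K) : r u ≤ 1 :=
    hr.2 ▸ Finset.single_le_sum (fun v _ => hr.1 v) (Finset.mem_univ u)
  exact abs_sub_le_iff.2 ⟨by linarith [le_one hp, hq.1 u], by linarith [le_one hq, hp.1 u]⟩

/-- A sequence bounded by `1`, and by `ε` from index `a` on, has partial sums bounded by `n * ε`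
plus the excess `1 - ε` (if positive) for each of the at most `a + 1` initial terms. -/
theorem sum_range_le_of_eventually_le {f : ℕ → ℝ} {a ε : ℝ} (ha : 0 ≤ a)
    (h_one : ∀ k, f k ≤ 1) (h_eps : ∀ k : ℕ, a ≤ k → f k ≤ ε) (n : ℕ) :
    ∑ k ∈ Finset.range n, f k ≤ n * ε + (a + 1) * max (1 - ε) 0 := by
  have hcard : (((Finset.range n).filter fun k : ℕ => (k : ℝ) < a).card : ℝ) ≤ a + 1 := by
    have hsub : ((Finset.range n).filter fun k : ℕ => (k : ℝ) < a) ⊆ Finset.range ⌈a⌉₊ := by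
      intro k hk
      exact Finset.mem_range.2 (Nat.lt_ceil.2 (Finset.mem_filter.1 hk).2)
    have hle := Finset.card_le_card hsub
    rw [Finset.card_range] at hle
    exact (Nat.cast_le.2 hle).trans (Nat.ceil_lt_add_one ha).le
  calc ∑ k ∈ Finset.range n, f k
      ≤ ∑ k ∈ Finset.range n, (ε + if (k : ℝ) < a then max (1 - ε) 0 else 0) := by
        refine Finset.sum_le_sum fun k _ => ?_
        split_ifs with hk
        · linarith [h_one k, le_max_left (1 - ε) 0]
        · linarith [h_eps k (not_lt.1 hk)]
    _ = n * ε + ((Finset.range n).filter fun k : ℕ => (k : ℝ) < a).card * max (1 - ε) 0 := by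
        rw [Finset.sum_add_distrib, ← Finset.sum_filter]
        simp
    _ ≤ n * ε + (a + 1) * max (1 - ε) 0 := by
        gcongr

/-- If `N ≥ ((2K+1)/ε)⁴`, the plug-in proportions `q(k)` lie in the
simplex and satisfy `|q_u(k) − q*_u| ≤ ε` for all `k ≥ N^{1/4}`, and the counts `N_u(n)`
track the cumulative proportions up to error `K(1+√n)`, then for every `n ∈ [√N, N]` and
every coordinate `u`, `|N_u(n)/n − q*_u| ≤ 2ε`. -/
theorem empirical_proportions_close
    (K : ℕ) (hK : 1 ≤ K) (ε : ℝ) (hε : 0 < ε)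
    (N : ℕ) (hN : ((2 * (K : ℝ) + 1) / ε) ^ 4 ≤ (N : ℝ))
    (qstar : Fin K → ℝ) (hqstar : qstar ∈ simplex K)
    (q : ℕ → Fin K → ℝ) (hq : ∀ k, q k ∈ simplex K)
    (hclose : ∀ u, ∀ k : ℕ, (N : ℝ) ^ ((1 : ℝ) / 4) ≤ (k : ℝ) → |q k u - qstar u| ≤ ε)
    (Ncount : Fin K → ℕ → ℝ) (hNnn : ∀ u n, 0 ≤ Ncount u n)
    (htrack : ∀ u (n : ℕ),
      |Ncount u n - ∑ k ∈ Finset.range n, q k u| ≤ K * (1 + Real.sqrt n)) :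
    ∀ n : ℕ, Real.sqrt N ≤ (n : ℝ) → n ≤ N → ∀ u,
      |Ncount u n / n - qstar u| ≤ 2 * ε := by
  intro n hn _ u
  have hK' : (1 : ℝ) ≤ K := by exact_mod_cast hK
  have hN0 : (0 : ℝ) < N := lt_of_lt_of_le (by positivity) hN
  have hN1 : (1 : ℝ) ≤ N := by exact_mod_cast (Nat.cast_pos.1 hN0 : 0 < N)
  set a : ℝ := (N : ℝ) ^ ((1 : ℝ) / 4) with ha
  have ha1 : 1 ≤ a := Real.one_le_rpow hN1 (by norm_num)
  have ha4 : a ^ 4 = N := by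
    rw [ha, ← Real.rpow_natCast, ← Real.rpow_mul hN0.le]
    norm_num
  have hKa : (2 * (K : ℝ) + 1) / ε ≤ a :=
    le_of_pow_le_pow_left₀ four_ne_zero (by linarith) (ha4 ▸ hN)
  have han : a ≤ √(n : ℝ) := by
    refine Real.le_sqrt_of_sq_le (le_trans ?_ hn)
    exact Real.le_sqrt_of_sq_le (by rw [← ha4]; exact le_of_eq (by ring))
  have hn0 : (0 : ℝ) < n := Real.sqrt_pos.1 (by linarith)
  have hsum : |∑ k ∈ Finset.range n, q k u - n * qstar u| ≤
      n * ε + (a + 1) * max (1 - ε) 0 := by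
    have heq : ∑ k ∈ Finset.range n, q k u - n * qstar u =
        ∑ k ∈ Finset.range n, (q k u - qstar u) := by simp
    rw [heq]
    exact (Finset.abs_sum_le_sum_abs _ _).trans <| sum_range_le_of_eventually_le
      (by linarith) (fun k => abs_sub_le_one_of_mem_simplex (hq k) hqstar u) (hclose u) n
  have hquot : Ncount u n / n - qstar u = (Ncount u n - n * qstar u) / n := by
    field_simp
  rw [hquot, abs_div, abs_of_pos hn0, div_le_iff₀ hn0]
  refine (abs_sub_le _ (∑ k ∈ Finset.range n, q k u) _).trans ?_
  have hsq := Real.sq_sqrt hn0.le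
  set s := √(n : ℝ)
  have hεs : 2 * (K : ℝ) + 1 ≤ s * ε := (div_le_iff₀ hε).1 (hKa.trans han)
  have hεn : (2 * (K : ℝ) + 1) * s ≤ n * ε := by
    rw [← hsq]
    nlinarith
  have hmax : (a + 1) * max (1 - ε) 0 ≤ (s + 1) * max (1 - ε) 0 := by gcongr
  have hs : 1 ≤ s := ha1.trans han
  have htr := htrack u n
  rcases max_cases (1 - ε) 0 with ⟨h, _⟩ | ⟨h, _⟩ <;> rw [h] at hmax hsum <;> nlinarith
end

section
/- Let K ≥ 1 be an integer and for each k ≥ 0 set ε_k = (1/2)(K² + k)^{−1/2}. Let (p(k))_{k≥0} be a sequence of vectors in the probability simplex P ⊂ ℝ^K with p_u(k) ≥ ε_k for every coordinate u. Define a sequence of controls (u_n)_{n≥1} taking values in {1,…,K} by the tracking rule u_{n+1} ∈ argmax_{u} ( Σ_{k=0}^{n} p_u(k) − N_u(n) ), where N_u(n) = #{1 ≤ k ≤ n : u_k = u}. Then for every n ≥ 1 and every u ∈ {1,…,K}: (a) N_u(n) ≥ √(n + K²) − 2K, and (b) max_u | N_u(n) − Σ_{k=0}^{n−1} p_u(k)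 | ≤ K(1 + √n). -/
open Finset

theorem sqrt_add_one_sub_sqrt_le {x : ℝ} (hx : 0 < x) :
    Real.sqrt (x + 1) - Real.sqrt x ≤ 1 / (2 * Real.sqrt x) := by
  have hs : 0 < Real.sqrt x := Real.sqrt_pos.2 hx
  rw [le_div_iff₀ (by positivity)]
  nlinarith [Real.sq_sqrt hx.le, Real.sq_sqrt (by linarith : 0 ≤ x + 1),
    sq_nonneg (Real.sqrt (x + 1) - Real.sqrt x)]

theorem sqrt_add_sub_sqrt_le_sum {x : ℝ} (hx : 0 < x) (n : ℕ) :
    Real.sqrt (x + n) - Real.sqrt x ≤ ∑ k ∈ Finset.range n, 1 / (2 * Real.sqrt (x + k)) := by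
  induction n with
  | zero => simp
  | succ n ih =>
    rw [Finset.sum_range_succ]
    have h := sqrt_add_one_sub_sqrt_le (x := x + n) (by positivity)
    push_cast
    rw [← add_assoc]
    linarith

/-- If a family has sum zero and all its entries are at least `-1`, then every entry is at most
the number of indices minus one. -/
theorem le_card_sub_one_of_sum_eq_zero {ι : Type*} [Fintype ι] {f : ι → ℝ}
    (hsum : ∑ i, f i = 0) (hf : ∀ i, -1 ≤ f i) (a : ι) : f a ≤ Fintype.card ι - 1 := by
  have h := Finset.single_le_sum (f := fun i => f i + 1)
    (fun i _ => by linarith [hf i]) (Finset.mem_univ a)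
  simp only [Finset.sum_add_distrib, hsum, Finset.sum_const, Finset.card_univ, nsmul_eq_mul,
    mul_one, zero_add] at h
  linarith

theorem card_filter_Icc_succ {ι : Type*} [DecidableEq ι] (u : ℕ → ι) (a : ι) (n : ℕ) :
    ((Finset.Icc 1 (n + 1)).filter (fun k => u k = a)).card =
      ((Finset.Icc 1 n).filter (fun k => u k = a)).card + if u (n + 1) = a then 1 else 0 := by
  simp only [Finset.card_filter]
  exact Finset.sum_Icc_succ_top (by omega) _

/-- Under the tracking rule, the differences between the cumulative targets and the counts sum to
zero, and the counts never exceed the cumulative targets by more than one. -/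
theorem sum_tracking_error_eq_zero_and_neg_one_le {K : ℕ} {p : ℕ → Fin K → ℝ}
    (hp : ∀ k, p k ∈ simplex K)
    {u : ℕ → Fin K} {N : Fin K → ℕ → ℕ} (hN0 : ∀ a, N a 0 = 0)
    (hN : ∀ a n, N a (n + 1) = N a n + if u (n + 1) = a then 1 else 0)
    (hrule : ∀ (n : ℕ) (a : Fin K),
      (∑ k ∈ Finset.range (n + 1), p k a) - (N a n : ℝ) ≤
        (∑ k ∈ Finset.range (n + 1), p k (u (n + 1))) - (N (u (n + 1)) n : ℝ)) (n : ℕ) :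
    (∑ a, ((∑ k ∈ Finset.range n, p k a) - (N a n : ℝ)) = 0) ∧
      ∀ a, -1 ≤ (∑ k ∈ Finset.range n, p k a) - (N a n : ℝ) := by
  induction n with
  | zero => simp [hN0]
  | succ n ih =>
    obtain ⟨hsum, hlow⟩ := ih
    have hsum' : ∑ a, ((∑ k ∈ Finset.range (n + 1), p k a) - (N a n : ℝ)) = 1 := by
      simp only [Finset.sum_range_succ, add_sub_right_comm]
      rw [Finset.sum_add_distrib, hsum, (hp n).2, zero_add]
    refine ⟨?_, fun a => ?_⟩
    · simp only [hN, Nat.cast_add, ← sub_sub, Finset.sum_sub_distrib _ _] at hsum' ⊢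
      rw [hsum']
      simp
    · by_cases h : u (n + 1) = a
      · have hmax : 0 ≤ (∑ k ∈ Finset.range (n + 1), p k a) - (N a n : ℝ) := by
          by_contra! hneg
          have hle : ∑ a, ((∑ k ∈ Finset.range (n + 1), p k a) - (N a n : ℝ)) ≤ 0 :=
            Finset.sum_nonpos fun b _ => ((hrule n b).trans (by rw [h])).trans hneg.le
          linarith
        rw [hN, if_pos h]
        push_cast
        linarith
      · rw [hN, if_neg h, Finset.sum_range_succ, add_zero]
        linarith [hlow a, (hp n).1 a]

/-- deterministic tracking lemma, Lemma 7 of Garivier–Kaufmann.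
With `ε_k = (1/2)(K² + k)^{−1/2}`, if each target vector `p(k)` lies in the simplex with
all coordinates at least `ε_k`, and the controls are chosen by the tracking rule
`u_{n+1} ∈ argmax_a (∑_{k=0}^n p_a(k) − N_a(n))`, where `N_a(n) = #{1 ≤ k ≤ n : u_k = a}`,
then for every `n ≥ 1` and every control `a`:
(a) `N_a(n) ≥ √(n + K²) − 2K`, and
(b) `|N_a(n) − ∑_{k=0}^{n−1} p_a(k)| ≤ K(1 + √n)`. -/
theorem tracking_lemma
    (K : ℕ) (hK : 1 ≤ K)
    (p : ℕ → Fin K → ℝ) (hp : ∀ k, p k ∈ simplex K)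
    (hlb : ∀ (k : ℕ) (a : Fin K), 1 / (2 * Real.sqrt ((K : ℝ) ^ 2 + k)) ≤ p k a)
    (u : ℕ → Fin K)
    (Ncount : Fin K → ℕ → ℕ)
    (hN : ∀ (a : Fin K) (n : ℕ),
      Ncount a n = ((Finset.Icc 1 n).filter (fun k => u k = a)).card)
    (hrule : ∀ (n : ℕ) (a : Fin K),
      (∑ k ∈ Finset.range (n + 1), p k a) - (Ncount a n : ℝ) ≤
        (∑ k ∈ Finset.range (n + 1), p k (u (n + 1))) - (Ncount (u (n + 1)) n : ℝ)) :
    ∀ n : ℕ, 1 ≤ n → ∀ a : Fin K,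
      (Real.sqrt ((n : ℝ) + (K : ℝ) ^ 2) - 2 * K ≤ (Ncount a n : ℝ)) ∧
      |(Ncount a n : ℝ) - ∑ k ∈ Finset.range n, p k a| ≤ K * (1 + Real.sqrt n) := by
  intro n _ a
  obtain ⟨hsum, hlow⟩ := sum_tracking_error_eq_zero_and_neg_one_le hp (fun a => by simp [hN])
    (fun a n => by rw [hN, hN, card_filter_Icc_succ]) hrule n
  have hup := le_card_sub_one_of_sum_eq_zero hsum hlow a
  rw [Fintype.card_fin] at hup
  have hK' : (1 : ℝ) ≤ K := by exact_mod_cast hK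
  constructor
  · have h := (sqrt_add_sub_sqrt_le_sum (x := (K : ℝ) ^ 2) (by positivity) n).trans
      (Finset.sum_le_sum fun k _ => hlb k a)
    rw [Real.sqrt_sq (by positivity), add_comm] at h
    linarith
  · have h : 0 ≤ (K : ℝ) * Real.sqrt n := by positivity
    rw [abs_le]
    constructor <;> linarith [hlow a]
end
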